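/- Let i* = max{ j ∈ {1,...,n} : p_j > p̄({1,...,j−1}) }, which is well defined since p_1 > 0 = p̄(∅). Define x* ∈ ℝ^n by x*_i = a_i R_l / (p_i · Σ_{j=1}^{i*} a_j/p_j) for i ≤ i* and x*_i = 0 for i > i*. Then x* ∈ 𝒳 and x* is optimal for the leader, i.e., P(x*) ≥ P(x) for all x ∈ 𝒳. -/

import Mathlib

open Finset

/-- The leader's strategy set 𝒳. -/
def leaderSet (n : ℕ) (Rl : ℝ) : Set (Fin n → ℝ) :=
  {x | (∀ i, 0 ≤ x i) ∧ ∑ i, x i ≤ Rl}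

/-- The follower's strategy set 𝒴. -/
def followerSet (n : ℕ) (a : Fin n → ℝ) (Rf : ℝ) : Set (Fin n → ℝ) :=
  {y | (∀ i, 0 ≤ y i ∧ y i ≤ a i) ∧ ∑ i, y i ≤ Rf}

/-- Total production after destruction P(x,y). -/
noncomputable def totProd (n : ℕ) (p a : Fin n → ℝ) (x y : Fin n → ℝ) : ℝ :=
  ∑ i, p i * x i * (1 - y i / a i)

/-- Worst case total production after destruction P(x) = min over 𝒴. -/
noncomputable def worstProd (n : ℕ) (p a : Fin n → ℝ) (Rf : ℝ) (x : Fin n → ℝ) : ℝ :=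
  sInf (totProd n p a x '' followerSet n a Rf)

/-- The composed net production rate p̄(S). -/
noncomputable def pbar (n : ℕ) (p a : Fin n → ℝ) (Rf : ℝ) (S : Finset (Fin n)) : ℝ :=
  if S = ∅ then 0
  else max ((∑ i ∈ S, a i - Rf) / (∑ i ∈ S, a i / p i)) 0

/-- A balanced strategy with support S. -/
def BalancedStrategy (n : ℕ) (p a : Fin n → ℝ) (Rl : ℝ)
    (x : Fin n → ℝ) (S : Finset (Fin n)) : Prop :=
  ∑ i, x i = Rl ∧ (∀ i ∈ S, 0 < x i) ∧
  (∀ i ∈ S, ∀ j ∈ S, p i * x i / a i = p j * x j / a j) ∧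
  ∀ i, i ∉ S → x i = 0

/-- A semi-balanced strategy with support S and extra facility r. -/
def SemiBalancedStrategy (n : ℕ) (p a : Fin n → ℝ) (Rl : ℝ)
    (x : Fin n → ℝ) (S : Finset (Fin n)) (r : Fin n) : Prop :=
  r ∉ S ∧ ∑ i, x i = Rl ∧ (∀ i ∈ insert r S, 0 < x i) ∧
  (∀ i ∈ S, ∀ j ∈ S, p i * x i / a i = p j * x j / a j) ∧
  (∀ i ∈ S, p r * x r / a r < p i * x i / a i) ∧
  ∀ i, i ∉ insert r S → x i = 0

lemma totProd_nonneg {n : ℕ} {p a x y : Fin n → ℝ} {Rf : ℝ} (hp : ∀ i, 0 < p i)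
    (ha : ∀ i, 0 < a i) (hx : ∀ i, 0 ≤ x i) (hy : y ∈ followerSet n a Rf) :
    0 ≤ totProd n p a x y := by
  refine Finset.sum_nonneg fun i _ => mul_nonneg (mul_nonneg (hp i).le (hx i)) ?_
  have := (div_le_one (ha i)).2 (hy.1 i).2
  linarith

lemma pbar_nonneg {n : ℕ} (p a : Fin n → ℝ) (Rf : ℝ) (S : Finset (Fin n)) :
    0 ≤ pbar n p a Rf S := by
  unfold pbar
  split_ifs
  · exact le_rfl
  · exact le_max_right _ _

lemma sum_div_pos {n : ℕ} {p a : Fin n → ℝ} (hp : ∀ i, 0 < p i) (ha : ∀ i, 0 < a i)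
    {S : Finset (Fin n)} (hS : S.Nonempty) : 0 < ∑ i ∈ S, a i / p i :=
  Finset.sum_pos (fun i _ => div_pos (ha i) (hp i)) hS

lemma pbar_of_nonempty {n : ℕ} (p a : Fin n → ℝ) (Rf : ℝ) {S : Finset (Fin n)}
    (hS : S.Nonempty) :
    pbar n p a Rf S = max ((∑ i ∈ S, a i - Rf) / (∑ i ∈ S, a i / p i)) 0 :=
  if_neg hS.ne_empty

lemma sum_sub_le_pbar_mul {n : ℕ} {p a : Fin n → ℝ} (hp : ∀ i, 0 < p i) (ha : ∀ i, 0 < a i)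
    {Rf : ℝ} (hRf : 0 < Rf) (S : Finset (Fin n)) :
    ∑ i ∈ S, a i - Rf ≤ pbar n p a Rf S * ∑ i ∈ S, a i / p i := by
  rcases S.eq_empty_or_nonempty with rfl | hS
  · simp [hRf.le]
  · rw [← div_le_iff₀ (sum_div_pos hp ha hS), pbar_of_nonempty p a Rf hS]
    exact le_max_left _ _

/-- Adding a facility that is more productive than `pbar S` keeps the composed net production
rate below the production rate of that facility. -/
lemma pbar_insert_le {n : ℕ} {p a : Fin n → ℝ} (hp : ∀ i, 0 < p i) (ha : ∀ i, 0 < a i)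
    {Rf : ℝ} (hRf : 0 < Rf) {S : Finset (Fin n)} {r : Fin n} (hr : r ∉ S)
    (h : pbar n p a Rf S < p r) : pbar n p a Rf (insert r S) ≤ p r := by
  have hne : (insert r S).Nonempty := Finset.insert_nonempty r S
  rw [pbar_of_nonempty p a Rf hne]
  refine max_le ?_ (hp r).le
  rw [div_le_iff₀ (sum_div_pos hp ha hne), Finset.sum_insert hr, Finset.sum_insert hr, mul_add,
    mul_div_cancel₀ _ (hp r).ne']
  have h1 := sum_sub_le_pbar_mul hp ha hRf S
  have h2 : pbar n p a Rf S * ∑ i ∈ S, a i / p i ≤ p r * ∑ i ∈ S, a i / p i :=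
    mul_le_mul_of_nonneg_right h.le (Finset.sum_nonneg fun i _ => (div_pos (ha i) (hp i)).le)
  linarith

/-- If every facility of `S` is at least as productive as `pbar S` and every other facility at
most as productive, then no leader strategy guarantees more than `pbar S * Rl`. -/
lemma worstProd_le_pbar_mul {n : ℕ} {p a : Fin n → ℝ} (hp : ∀ i, 0 < p i) (ha : ∀ i, 0 < a i)
    {Rl Rf : ℝ} (hRf : 0 < Rf) {S : Finset (Fin n)}
    (hin : ∀ i ∈ S, pbar n p a Rf S ≤ p i) (hout : ∀ i ∉ S, p i ≤ pbar n p a Rf S)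
    {x : Fin n → ℝ} (hx : x ∈ leaderSet n Rl) :
    worstProd n p a Rf x ≤ pbar n p a Rf S * Rl := by
  have hsum := sum_sub_le_pbar_mul hp ha hRf S
  have hv := pbar_nonneg p a Rf S
  set v := pbar n p a Rf S
  set y : Fin n → ℝ := fun i => if i ∈ S then a i - v * (a i / p i) else 0 with hy
  have hyF : y ∈ followerSet n a Rf := by
    refine ⟨fun i => ?_, ?_⟩
    · by_cases hi : i ∈ S
      · have h1 : v * (a i / p i) ≤ p i * (a i / p i) :=
          mul_le_mul_of_nonneg_right (hin i hi) (div_pos (ha i) (hp i)).le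
        rw [mul_div_cancel₀ _ (hp i).ne'] at h1
        have h2 : 0 ≤ v * (a i / p i) := mul_nonneg hv (div_pos (ha i) (hp i)).le
        simp only [hy, if_pos hi]
        constructor <;> linarith
      · simp [hy, hi, (ha i).le]
    · have : ∑ i, y i = ∑ i ∈ S, a i - v * ∑ i ∈ S, a i / p i := by
        simp only [hy, Finset.sum_ite_mem, Finset.univ_inter, Finset.sum_sub_distrib,
          Finset.mul_sum]
      linarith
  have hbdd : BddBelow (totProd n p a x '' followerSet n a Rf) := by
    refine ⟨0, ?_⟩
    rintro _ ⟨z, hz, rfl⟩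
    exact totProd_nonneg hp ha hx.1 hz
  calc worstProd n p a Rf x ≤ totProd n p a x y := csInf_le hbdd ⟨y, hyF, rfl⟩
    _ ≤ ∑ i, v * x i := by
        refine Finset.sum_le_sum fun i _ => ?_
        have hpi := (hp i).ne'
        have hai := (ha i).ne'
        by_cases hi : i ∈ S
        · simp only [hy, if_pos hi]
          apply le_of_eq
          field_simp
          ring
        · simp only [hy, if_neg hi, zero_div, sub_zero, mul_one]
          exact mul_le_mul_of_nonneg_right (hout i hi) (hx.1 i)
    _ = v * ∑ i, x i := (Finset.mul_sum _ _ _).symm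
    _ ≤ v * Rl := mul_le_mul_of_nonneg_left hx.2 hv

/-- The strategy with support `S` that uses all resources and balances the weighted production
`p i * x i / a i`. -/
noncomputable def balanced {n : ℕ} (p a : Fin n → ℝ) (Rl : ℝ) (S : Finset (Fin n)) :
    Fin n → ℝ :=
  fun i => if i ∈ S then a i * Rl / (p i * ∑ j ∈ S, a j / p j) else 0

lemma balanced_mem_leaderSet {n : ℕ} {p a : Fin n → ℝ} (hp : ∀ i, 0 < p i)
    (ha : ∀ i, 0 < a i) {Rl : ℝ} (hRl : 0 < Rl) {S : Finset (Fin n)} (hS : S.Nonempty) :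
    balanced p a Rl S ∈ leaderSet n Rl := by
  have hD := sum_div_pos hp ha hS
  refine ⟨fun i => ?_, ?_⟩
  · unfold balanced
    split_ifs
    · exact (div_pos (mul_pos (ha i) hRl) (mul_pos (hp i) hD)).le
    · exact le_rfl
  · simp only [balanced, Finset.sum_ite_mem, Finset.univ_inter]
    have : ∀ i ∈ S, a i * Rl / (p i * ∑ j ∈ S, a j / p j)
        = a i / p i * (Rl / ∑ j ∈ S, a j / p j) := fun i _ => mul_div_mul_comm _ _ _ _
    rw [Finset.sum_congr rfl this, ← Finset.sum_mul, mul_div_cancel₀ _ hD.ne']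

lemma pbar_mul_le_worstProd_balanced {n : ℕ} {p a : Fin n → ℝ} (hp : ∀ i, 0 < p i)
    (ha : ∀ i, 0 < a i) {Rl Rf : ℝ} (hRl : 0 < Rl) (hRf : 0 < Rf) {S : Finset (Fin n)}
    (hS : S.Nonempty) : pbar n p a Rf S * Rl ≤ worstProd n p a Rf (balanced p a Rl S) := by
  have hD := sum_div_pos hp ha hS
  have hne : (followerSet n a Rf).Nonempty :=
    ⟨0, fun i => ⟨le_rfl, (ha i).le⟩, by simpa using hRf.le⟩
  refine le_csInf (hne.image _) ?_
  rintro _ ⟨y, hy, rfl⟩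
  have hnonneg := totProd_nonneg (p := p) hp ha (balanced_mem_leaderSet hp ha hRl hS).1 hy
  have hprod : totProd n p a (balanced p a Rl S) y
      = (∑ i ∈ S, a i - ∑ i ∈ S, y i) / (∑ i ∈ S, a i / p i) * Rl := by
    have hterm : ∀ i, p i * balanced p a Rl S i * (1 - y i / a i)
        = if i ∈ S then (a i - y i) * (Rl / ∑ j ∈ S, a j / p j) else 0 := by
      intro i
      unfold balanced
      have hpi := (hp i).ne'
      have hai := (ha i).ne'
      have hD' := hD.ne'
      generalize ∑ j ∈ S, a j / p j = D at hD'
      split_ifs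
      · field_simp
      · simp
    simp only [totProd, hterm, Finset.sum_ite_mem, Finset.univ_inter]
    rw [← Finset.sum_mul, Finset.sum_sub_distrib]
    ring
  rw [pbar_of_nonempty p a Rf hS, max_mul_of_nonneg _ _ hRl.le, zero_mul]
  refine max_le ?_ hnonneg
  have hyS : ∑ i ∈ S, y i ≤ Rf :=
    (Finset.sum_le_univ_sum_of_nonneg fun i => (hy.1 i).1).trans hy.2
  rw [hprod]
  gcongr

theorem algorithmOutputOptimal {n : ℕ} (hn : 0 < n) (p a : Fin n → ℝ)
    (hp : ∀ i, 0 < p i) (hpmono : ∀ i j : Fin n, i ≤ j → p j ≤ p i)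
    (ha : ∀ i, 0 < a i) (Rl Rf : ℝ) (hRl : 0 < Rl) (hRf : 0 < Rf)
    (hRfa : Rf < ∑ i, a i)
    (istar : Fin n)
    (histar1 : pbar n p a Rf (Finset.filter (fun i => i < istar) Finset.univ) < p istar)
    (histar2 : ∀ j : Fin n,
      pbar n p a Rf (Finset.filter (fun i => i < j) Finset.univ) < p j → j ≤ istar)
    (xstar : Fin n → ℝ)
    (hxstar : ∀ i, xstar i =
      if i ≤ istar then
        a i * Rl / (p i * ∑ j ∈ Finset.filter (fun j => j ≤ istar) Finset.univ, a j / p j)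
      else 0) :
    xstar ∈ leaderSet n Rl ∧
      ∀ x ∈ leaderSet n Rl, worstProd n p a Rf x ≤ worstProd n p a Rf xstar := by
  set S : Finset (Fin n) := Finset.univ.filter (fun j => j ≤ istar) with hSdef
  have hmem : ∀ i, i ∈ S ↔ i ≤ istar := fun i => by simp [hSdef]
  have hS : S.Nonempty := ⟨istar, (hmem istar).2 le_rfl⟩
  have hx : xstar = balanced p a Rl S := by
    funext i
    simp only [hxstar, balanced, hmem]
  have hinsert : S = insert istar (Finset.univ.filter (fun i => i < istar)) := by
    ext i
    simp [hmem, le_iff_eq_or_lt]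
  have hin : ∀ i ∈ S, pbar n p a Rf S ≤ p i := by
    intro i hi
    refine le_trans ?_ (hpmono i istar ((hmem i).1 hi))
    rw [hinsert]
    exact pbar_insert_le hp ha hRf (by simp) histar1
  have hout : ∀ i ∉ S, p i ≤ pbar n p a Rf S := by
    intro i hi
    rw [hmem, not_le, Fin.lt_def] at hi
    let j : Fin n := ⟨istar + 1, lt_of_le_of_lt hi i.isLt⟩
    have hj : Finset.univ.filter (fun k => k < j) = S := by
      ext k
      rw [hmem, Finset.mem_filter, Fin.lt_def, Fin.le_def]
      exact (and_iff_right (Finset.mem_univ k)).trans Nat.lt_succ_iff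
    have hle : p j ≤ pbar n p a Rf S := by
      by_contra! hlt
      rw [← hj] at hlt
      have := histar2 j hlt
      simp [j, Fin.le_def] at this
    exact (hpmono j i hi).trans hle
  rw [hx]
  exact ⟨balanced_mem_leaderSet hp ha hRl hS, fun x hxl =>
    (worstProd_le_pbar_mul hp ha hRf hin hout hxl).trans
      (pbar_mul_le_worstProd_balanced hp ha hRl hRf hS)⟩
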